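/- Any triangle-free graph on n ≥ 2 vertices with minimum degree at least d > 0 has list chromatic number at most ⌈(n/d) · log n⌉. -/

import Mathlib

/-- `G` has list chromatic number at most `k`: for every assignment of colour lists of size
`k` to the vertices there is a proper colouring choosing each vertex's colour from its list. -/
def SimpleGraph.ListChromAtMost {V : Type*} (G : SimpleGraph V) (k : ℕ) : Prop :=
  ∀ L : V → Finset ℕ, (∀ v, (L v).card = k) →
    ∃ c : V → ℕ, (∀ v, c v ∈ L v) ∧ ∀ u v, G.Adj u v → c u ≠ c v

/-- If `x : C → V` gives every vertex `v` a colour in its list whose representative `x c` is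
adjacent to `v`, then in a triangle-free graph the lists admit a proper colouring. -/
theorem SimpleGraph.CliqueFree.exists_listColoring_of_representatives {V C : Type*}
    {G : SimpleGraph V} (htf : G.CliqueFree 3) (L : V → Finset C) (x : C → V)
    (hx : ∀ v, ∃ c ∈ L v, G.Adj v (x c)) :
    ∃ c : V → C, (∀ v, c v ∈ L v) ∧ ∀ u v, G.Adj u v → c u ≠ c v := by
  classical
  choose c hcL hc using hx
  refine ⟨c, hcL, fun u v huv heq => ?_⟩
  exact htf {u, v, x (c v)} (is3Clique_triple_iff.2 ⟨huv, heq ▸ hc u, hc v⟩)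

/-- A union bound: if the densities of functions `S → V` avoiding `N v` on all colours of `L v`
add up to less than one, then some function hits `N v` on `L v` for every `v`. -/
theorem Finset.exists_forall_exists_mem_of_sum_pow_lt_one {V C : Type*} [Fintype V] [Nonempty V]
    [DecidableEq V] [DecidableEq C] (N : V → Finset V) (L : V → Finset C)
    (h : ∑ v, (1 - ((N v).card : ℝ) / Fintype.card V) ^ (L v).card < 1) :
    ∃ x : C → V, ∀ v, ∃ c ∈ L v, x c ∈ N v := by
  classical
  set S : Finset C := univ.biUnion L
  have hLS : ∀ v, L v ⊆ S := fun v => subset_biUnion_of_mem L (mem_univ v)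
  have hn : (0 : ℝ) < Fintype.card V := by exact_mod_cast Fintype.card_pos
  let B : V → Finset (S → V) := fun v =>
    Fintype.piFinset fun c => if (c : C) ∈ L v then (N v)ᶜ else univ
  have hB : ∀ v, ((B v).card : ℝ) =
      (Fintype.card V : ℝ) ^ S.card * (1 - ((N v).card : ℝ) / Fintype.card V) ^ (L v).card := by
    intro v
    have hfactor : ∀ c : S, (((if (c : C) ∈ L v then (N v)ᶜ else univ : Finset V).card : ℕ) : ℝ) =
        Fintype.card V * if (c : C) ∈ L v then 1 - ((N v).card : ℝ) / Fintype.card V else 1 := by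
      intro c
      split_ifs
      · rw [card_compl, Nat.cast_sub (card_le_univ _)]
        field_simp
      · simp
    rw [Fintype.card_piFinset, Nat.cast_prod, prod_congr rfl fun c _ => hfactor c,
      prod_mul_distrib, prod_const, card_univ, Fintype.card_coe,
      prod_coe_sort S fun c => if c ∈ L v then 1 - ((N v).card : ℝ) / Fintype.card V else 1,
      prod_ite_mem, inter_eq_right.2 (hLS v), prod_const]
  obtain ⟨f, hf⟩ : ∃ f : S → V, ∀ v, f ∉ B v := by
    by_contra! hcon
    have hsub : (univ : Finset (S → V)) ⊆ univ.biUnion B := fun f _ => by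
      simpa using hcon f
    have hle : (Fintype.card V : ℝ) ^ S.card ≤ ∑ v, ((B v).card : ℝ) := by
      have := (card_le_card hsub).trans card_biUnion_le
      rw [card_univ, Fintype.card_fun, Fintype.card_coe] at this
      exact_mod_cast this
    simp_rw [hB, ← mul_sum] at hle
    exact (mul_lt_of_lt_one_right (pow_pos hn _) h).not_ge hle
  refine ⟨fun c => if hc : c ∈ S then f ⟨c, hc⟩ else Classical.arbitrary V, fun v => ?_⟩
  have hfv := hf v
  simp only [B, Fintype.mem_piFinset, not_forall] at hfv
  obtain ⟨⟨c, hcS⟩, hc⟩ := hfv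
  by_cases hcL : c ∈ L v
  · exact ⟨c, hcL, by simpa [hcL, hcS] using hc⟩
  · simp [hcL] at hc

/-- Any triangle-free graph on `n ≥ 2` vertices with minimum degree at least `d > 0` has
list chromatic number at most `⌈(n/d) · log n⌉`. -/
theorem listChrom_le_of_triangleFree {V : Type*} [Fintype V] [DecidableEq V]
    (G : SimpleGraph V) [DecidableRel G.Adj] (n d : ℕ)
    (hn : Fintype.card V = n) (hn2 : 2 ≤ n) (hd : 0 < d)
    (htf : G.CliqueFree 3) (hmin : ∀ v, d ≤ G.degree v) :
    G.ListChromAtMost ⌈((n : ℝ) / d) * Real.log n⌉₊ := by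
  intro L hL
  set k := ⌈((n : ℝ) / d) * Real.log n⌉₊
  have hn0 : (0 : ℝ) < n := by exact_mod_cast (by omega : 0 < n)
  have hd0 : (0 : ℝ) < d := by exact_mod_cast hd
  have hlog : 0 < Real.log n := Real.log_pos (by exact_mod_cast hn2)
  have hk0 : k ≠ 0 := (Nat.ceil_pos.2 (by positivity)).ne'
  have : Nonempty V := Fintype.card_pos_iff.1 (by omega)
  have hbound : ∀ v, (1 - ((G.neighborFinset v).card : ℝ) / Fintype.card V) ^ (L v).card <
      (n : ℝ)⁻¹ := by
    intro v
    rw [hL, hn, G.card_neighborFinset_eq_degree]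
    have hdeg : (d : ℝ) ≤ G.degree v := by exact_mod_cast hmin v
    have hdeg_le : (G.degree v : ℝ) ≤ n := by
      rw [← hn]
      exact_mod_cast (G.degree_lt_card_verts v).le
    calc (1 - (G.degree v : ℝ) / n) ^ k ≤ (1 - (d : ℝ) / n) ^ k := by
          have : (G.degree v : ℝ) / n ≤ 1 := (div_le_one hn0).2 hdeg_le
          gcongr
      _ < Real.exp (-((d : ℝ) / n)) ^ k := by
          have : (d : ℝ) / n ≤ 1 := (div_le_one hn0).2 (hdeg.trans hdeg_le)
          refine pow_lt_pow_left₀ ?_ (by linarith) hk0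
          have := Real.add_one_lt_exp (x := -((d : ℝ) / n)) (by
            have : 0 < (d : ℝ) / n := by positivity
            linarith)
          linarith
      _ = Real.exp (-(k * (d / n))) := by
          rw [← Real.exp_nat_mul]
          ring_nf
      _ ≤ Real.exp (-Real.log n) := by
          have hceil : (n : ℝ) / d * Real.log n ≤ k := Nat.le_ceil _
          have hmul : (n : ℝ) / d * Real.log n * (d / n) ≤ k * (d / n) := by gcongr
          have heq : (n : ℝ) / d * Real.log n * (d / n) = Real.log n := by field_simp
          gcongr
          linarith
      _ = (n : ℝ)⁻¹ := by rw [Real.exp_neg, Real.exp_log hn0]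
  have hsum : ∑ v, (1 - ((G.neighborFinset v).card : ℝ) / Fintype.card V) ^ (L v).card < 1 :=
    calc _ < ∑ _v : V, (n : ℝ)⁻¹ :=
          Finset.sum_lt_sum_of_nonempty Finset.univ_nonempty fun v _ => hbound v
      _ = 1 := by
          rw [Finset.sum_const, Finset.card_univ, hn, nsmul_eq_mul, mul_inv_cancel₀ hn0.ne']
  obtain ⟨x, hx⟩ := Finset.exists_forall_exists_mem_of_sum_pow_lt_one
    (fun v => G.neighborFinset v) L hsum
  exact htf.exists_listColoring_of_representatives L x (by simpa using hx)
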